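/- arXiv:0707.3401 — 2 statements merged into one kernel-verified Lean document; each statement's English description precedes it below -/
import Mathlib

section
/- Fix τ ∈ (0,π), γ ∈ 𝕋 and a finite positive Borel measure σ on 𝕋. Let {μ_{nk}} be an infinitesimal array of probability measures on 𝕋, each with nonzero first moment, and let {λ_n}_{n≥1} ⊂ 𝕋. If the measures σ_n converge weakly on 𝕋 to σ and γ_n → γ as n → ∞, then λ_n · Π_{k=1}^{k_n} B_{μ_{nk}}(z) converges to γ·exp(−∫_𝕋 (1+ζz)/(1−ζz) dσ(ζ)) uniformly on compact subsets of 𝔻 as n → ∞ (i.e., the boolean convolutions δ_{λ_n} ⨃ μ_{n1} ⨃ ⋯ ⨃ μ_{nk_n} converge weakly to ν_⨃^{γ,σ}). -/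
open MeasureTheory Complex Filter Topology Metric

noncomputable section

instance : MeasurableSpace Circle := borel Circle
instance : BorelSpace Circle := ⟨rfl⟩

/-- ψ_μ(z) = ∫ ζz/(1-ζz) dμ(ζ). -/
def psiT (μ : Measure Circle) (z : ℂ) : ℂ :=
  ∫ ζ : Circle, ((ζ : ℂ) * z) / (1 - (ζ : ℂ) * z) ∂μ

/-- The B-transform of a measure on the circle:
B_μ(z) = (1/z)·ψ_μ(z)/(1+ψ_μ(z)) for z ≠ 0 and B_μ(0) = ∫ ζ dμ. -/
def BT (μ : Measure Circle) (z : ℂ) : ℂ :=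
  if z = 0 then ∫ ζ : Circle, (ζ : ℂ) ∂μ
  else z⁻¹ * (psiT μ z / (1 + psiT μ z))

/-- Infinitesimal triangular array: max_{1≤k≤k_n} μ_{nk}{|ζ-1| ≥ ε} → 0 as n → ∞. -/
def IsInfinitesimalArrayT (kn : ℕ → ℕ) (μ : ℕ → ℕ → Measure Circle) : Prop :=
  ∀ ε : ℝ, 0 < ε → ∀ δ : ENNReal, 0 < δ → ∃ N : ℕ, ∀ n ≥ N, ∀ i < kn n,
    μ n i {ζ : Circle | ε ≤ ‖(ζ : ℂ) - 1‖} < δ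

/-- β = ∫_{|arg ζ|<τ} arg ζ dμ. -/
def betaT (τ : ℝ) (μ : Measure Circle) : ℝ :=
  ∫ ζ in {ζ : Circle | |Complex.arg (ζ : ℂ)| < τ}, Complex.arg (ζ : ℂ) ∂μ

/-- b = e^{iβ} as an element of the circle. -/
def bT (τ : ℝ) (μ : Measure Circle) : Circle := Circle.exp (betaT τ μ)

/-- μ° : the centering of μ, i.e. the pushforward of μ under ζ ↦ b⁻¹ ζ. -/
def centerT (τ : ℝ) (μ : Measure Circle) : Measure Circle :=
  Measure.map (fun ζ => (bT τ μ)⁻¹ * ζ) μ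

/-- h(z) = -i ∫ Im ζ dμ° + ∫ (1+ζz)/(1-ζz)·(1-Re ζ) dμ°, for the centered measure μ°. -/
def hT (τ : ℝ) (μ : Measure Circle) (z : ℂ) : ℂ :=
  -Complex.I * ((∫ ζ : Circle, ((ζ : ℂ)).im ∂(centerT τ μ) : ℝ) : ℂ) +
    ∫ ζ : Circle, ((1 + (ζ : ℂ) * z) / (1 - (ζ : ℂ) * z)) * ((1 - ((ζ : ℂ)).re : ℝ) : ℂ)
      ∂(centerT τ μ)

/-- The measure dσ_n(ζ) = Σ_{k=1}^{k_n} (1 − Re ζ) dμ_{nk}°(ζ). -/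
def sigmaNT (τ : ℝ) (kn : ℕ → ℕ) (μ : ℕ → ℕ → Measure Circle) (n : ℕ) : Measure Circle :=
  ∑ i ∈ Finset.range (kn n),
    (centerT τ (μ n i)).withDensity (fun ζ => ENNReal.ofReal (1 - ((ζ : ℂ)).re))

/-- γ_n = exp(i arg λ_n + i Σ_k β_{nk} + i Σ_k ∫ Im ζ dμ_{nk}°). -/
def gammaNT (τ : ℝ) (kn : ℕ → ℕ) (μ : ℕ → ℕ → Measure Circle) (lam : ℕ → Circle) (n : ℕ) : ℂ :=
  Complex.exp (Complex.I * ((Complex.arg (lam n : ℂ)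
    + ∑ i ∈ Finset.range (kn n), betaT τ (μ n i)
    + ∑ i ∈ Finset.range (kn n), ∫ ζ : Circle, ((ζ : ℂ)).im ∂(centerT τ (μ n i)) : ℝ) : ℂ))

/-- The B-transform of the ⨃-infinitely divisible measure ν_⨃^{γ,σ}:
B(z) = γ·exp(−∫ (1+ζz)/(1−ζz) dσ(ζ)). -/
def BID (γ : Circle) (σ : Measure Circle) (z : ℂ) : ℂ :=
  (γ : ℂ) * Complex.exp (-∫ ζ : Circle, (1 + (ζ : ℂ) * z) / (1 - (ζ : ℂ) * z) ∂σ)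

lemma Continuous.integrable_circle {E : Type*} [NormedAddCommGroup E] {f : Circle → E}
    (hf : Continuous f) (ν : Measure Circle) [IsFiniteMeasure ν] : Integrable f ν :=
  hf.integrable_of_hasCompactSupport (HasCompactSupport.of_compactSpace f)

section Trigonometry

lemma abs_sin_sub_self_le (x : ℝ) : |Real.sin x - x| ≤ 2 * x ^ 2 := by
  wlog hx : 0 ≤ x generalizing x
  · have h := this (-x) (by linarith)
    rw [Real.sin_neg, neg_sq, ← abs_neg] at h
    convert h using 2
    ring
  rcases hx.eq_or_lt with rfl | hx
  · simp
  have h1 := Real.sin_lt hx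
  have h2 := Real.sin_gt_sub_cube hx
  have h3 := Real.neg_one_le_sin x
  rw [abs_le]
  refine ⟨?_, by nlinarith⟩
  rcases le_total x 1 with h | h
  · nlinarith [mul_nonneg hx.le (sq_nonneg x), mul_le_mul_of_nonneg_right h (sq_nonneg x)]
  · nlinarith

lemma two_mul_sq_le_of_abs_le_pi {x : ℝ} (hx : |x| ≤ Real.pi) :
    2 * x ^ 2 ≤ Real.pi ^ 2 * (1 - Real.cos x) := by
  have h := Real.cos_le_one_sub_mul_cos_sq hx
  have hpi := Real.pi_pos
  have h2 : 2 / Real.pi ^ 2 * x ^ 2 ≤ 1 - Real.cos x := by linarith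
  rw [div_mul_eq_mul_div, div_le_iff₀ (by positivity)] at h2
  linarith

lemma Circle.norm_coe_sub_one_sq (w : Circle) : ‖(w : ℂ) - 1‖ ^ 2 = 2 * (1 - (w : ℂ).re) := by
  have h := Circle.normSq_coe w
  rw [Complex.normSq_apply] at h
  rw [Complex.sq_norm, Complex.normSq_apply]
  simp
  nlinarith

lemma Circle.one_sub_re_nonneg (w : Circle) : 0 ≤ 1 - (w : ℂ).re := by
  nlinarith [Circle.norm_coe_sub_one_sq w, sq_nonneg ‖(w : ℂ) - 1‖]

lemma Circle.one_sub_re_le_norm (w : Circle) : 1 - (w : ℂ).re ≤ ‖(w : ℂ) - 1‖ := by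
  have h := Circle.norm_coe_sub_one_sq w
  have h2 : ‖(w : ℂ) - 1‖ ≤ 2 := by
    refine (norm_sub_le _ _).trans ?_
    rw [Circle.norm_coe, norm_one]; norm_num
  nlinarith [norm_nonneg ((w : ℂ) - 1)]

lemma Circle.re_coe_exp (x : ℝ) : (Circle.exp x : ℂ).re = Real.cos x := by
  rw [Circle.coe_exp, Complex.exp_ofReal_mul_I_re]

lemma Circle.im_coe_exp (x : ℝ) : (Circle.exp x : ℂ).im = Real.sin x := by
  rw [Circle.coe_exp, Complex.exp_ofReal_mul_I_im]

lemma Circle.abs_arg_le_norm_sub_one (w : Circle) :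
    |Complex.arg (w : ℂ)| ≤ Real.pi / 2 * ‖(w : ℂ) - 1‖ := by
  have h := two_mul_sq_le_of_abs_le_pi (Complex.abs_arg_le_pi (w : ℂ))
  have h2 := Circle.norm_coe_sub_one_sq w
  rw [← Circle.re_coe_exp, Circle.exp_arg] at h
  apply abs_le_of_sq_le_sq _ (by positivity)
  nlinarith

lemma Circle.norm_exp_sub_one_le (x : ℝ) : ‖(Circle.exp x : ℂ) - 1‖ ≤ |x| := by
  rw [Circle.coe_exp, mul_comm]
  exact Real.norm_exp_I_mul_ofReal_sub_one_le

lemma Circle.norm_inv_mul_sub_one (b w : Circle) :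
    ‖((b⁻¹ * w : Circle) : ℂ) - 1‖ = ‖(w : ℂ) - b‖ := by
  have h : (w : ℂ) - b = b * (((b⁻¹ * w : Circle) : ℂ) - 1) := by
    rw [mul_sub, ← Circle.coe_mul, mul_inv_cancel_left, mul_one]
  rw [h, norm_mul, Circle.norm_coe, one_mul]

/-- After centering, the imaginary part differs from the centered truncated argument by at most a
multiple of the defect `1 - Re`. -/
lemma abs_im_sub_truncated_arg_add_le {τ β : ℝ} (hτ : 0 < τ) (hβ1 : |β| ≤ 1)
    (hβ2 : |β| ≤ τ / Real.pi) (hβ3 : |β| ≤ Real.pi - τ) (w : Circle) :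
    |(((Circle.exp β)⁻¹ * w : Circle) : ℂ).im
        - {ζ : Circle | |Complex.arg (ζ : ℂ)| < τ}.indicator (fun ζ => Complex.arg (ζ : ℂ)) w + β|
      ≤ (Real.pi ^ 2 + 4 * (Real.pi / τ) ^ 2) * (1 - (((Circle.exp β)⁻¹ * w : Circle) : ℂ).re) := by
  have hpi := Real.pi_pos
  have hnn := Circle.one_sub_re_nonneg ((Circle.exp β)⁻¹ * w)
  by_cases hw : |Complex.arg (w : ℂ)| < τ
  · rw [Set.indicator_of_mem (by exact hw)]
    have he : (Circle.exp β)⁻¹ * w = Circle.exp (Complex.arg (w : ℂ) - β) := by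
      rw [Circle.exp_sub, Circle.exp_arg, div_eq_inv_mul]
    rw [he] at hnn ⊢
    rw [Circle.re_coe_exp] at hnn ⊢
    rw [Circle.im_coe_exp]
    set x := Complex.arg (w : ℂ) - β with hx
    have hxp : |x| ≤ Real.pi := (abs_sub _ _).trans (by linarith)
    have h1 := abs_sin_sub_self_le x
    have h2 := two_mul_sq_le_of_abs_le_pi hxp
    rw [sub_add, ← hx]
    nlinarith [mul_nonneg (sq_nonneg (Real.pi / τ)) hnn]
  · rw [Set.indicator_of_notMem (by exact hw), sub_zero]
    have hd : τ / Real.pi ≤ ‖(w : ℂ) - (Circle.exp β : ℂ)‖ := by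
      have h1 := Circle.abs_arg_le_norm_sub_one w
      have h2 := Circle.norm_exp_sub_one_le β
      have h3 : ‖(w : ℂ) - 1‖ ≤ ‖(w : ℂ) - (Circle.exp β : ℂ)‖ + ‖(Circle.exp β : ℂ) - 1‖ :=
        norm_sub_le_norm_sub_add_norm_sub _ _ _
      have h4 : 2 * (τ / Real.pi) ≤ ‖(w : ℂ) - 1‖ := by
        rw [← mul_div_assoc, div_le_iff₀ hpi]
        nlinarith [not_lt.1 hw]
      linarith
    have h5 := Circle.norm_coe_sub_one_sq ((Circle.exp β)⁻¹ * w)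
    rw [Circle.norm_inv_mul_sub_one] at h5
    have h6 : (τ / Real.pi) ^ 2 ≤ 2 * (1 - (((Circle.exp β)⁻¹ * w : Circle) : ℂ).re) := by
      rw [← h5]
      gcongr
    have h7 : (Real.pi / τ) ^ 2 * (τ / Real.pi) ^ 2 = 1 := by
      field_simp
    have h8 : |(((Circle.exp β)⁻¹ * w : Circle) : ℂ).im| ≤ 1 :=
      (Complex.abs_im_le_norm _).trans (Circle.norm_coe _).le
    have h9 := abs_add_le (((Circle.exp β)⁻¹ * w : Circle) : ℂ).im β
    nlinarith [mul_le_mul_of_nonneg_left h6 (sq_nonneg (Real.pi / τ)),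
      mul_nonneg (sq_nonneg Real.pi) hnn]

end Trigonometry

section Kernel

lemma one_sub_le_norm_one_sub_mul {r : ℝ} {z : ℂ} (hz : ‖z‖ ≤ r) (ζ : Circle) :
    1 - r ≤ ‖1 - (ζ : ℂ) * z‖ := by
  have h := norm_sub_norm_le (1 : ℂ) ((ζ : ℂ) * z)
  rw [norm_mul, Circle.norm_coe, norm_one, one_mul] at h
  linarith

lemma one_sub_mul_ne_zero {z : ℂ} (hz : ‖z‖ < 1) (ζ : Circle) : 1 - (ζ : ℂ) * z ≠ 0 := by
  have h := one_sub_le_norm_one_sub_mul le_rfl ζ (z := z)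
  exact norm_pos_iff.1 (by linarith)

lemma continuous_herglotz {z : ℂ} (hz : ‖z‖ < 1) :
    Continuous fun ζ : Circle => (1 + (ζ : ℂ) * z) / (1 - (ζ : ℂ) * z) :=
  Continuous.div (by fun_prop) (by fun_prop) (one_sub_mul_ne_zero hz)

lemma norm_herglotz_le {r : ℝ} (hr : r < 1) {z : ℂ} (hz : ‖z‖ ≤ r) (ζ : Circle) :
    ‖(1 + (ζ : ℂ) * z) / (1 - (ζ : ℂ) * z)‖ ≤ 2 / (1 - r) := by
  have h := norm_add_le (1 : ℂ) ((ζ : ℂ) * z)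
  rw [norm_mul, Circle.norm_coe, norm_one, one_mul] at h
  rw [norm_div]
  exact div_le_div₀ zero_le_two (by linarith) (by linarith) (one_sub_le_norm_one_sub_mul hz ζ)

lemma norm_herglotz_sub_le {r : ℝ} (hr : r < 1) {z w : ℂ} (hz : ‖z‖ ≤ r) (hw : ‖w‖ ≤ r)
    (ζ : Circle) :
    ‖(1 + (ζ : ℂ) * z) / (1 - (ζ : ℂ) * z) - (1 + (ζ : ℂ) * w) / (1 - (ζ : ℂ) * w)‖
      ≤ 2 / (1 - r) ^ 2 * ‖z - w‖ := by
  have hz0 := one_sub_mul_ne_zero (hz.trans_lt hr) ζ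
  have hw0 := one_sub_mul_ne_zero (hw.trans_lt hr) ζ
  have he : (1 + (ζ : ℂ) * z) / (1 - (ζ : ℂ) * z) - (1 + (ζ : ℂ) * w) / (1 - (ζ : ℂ) * w)
      = 2 * ((ζ : ℂ) * (z - w)) / ((1 - (ζ : ℂ) * z) * (1 - (ζ : ℂ) * w)) := by
    field_simp
    ring
  have h1 : 0 < 1 - r := by linarith
  rw [he, norm_div, norm_mul, norm_mul, norm_mul, Circle.norm_coe, one_mul, Complex.norm_two,
    div_mul_eq_mul_div, sq]
  gcongr
  · exact one_sub_le_norm_one_sub_mul hz ζ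
  · exact one_sub_le_norm_one_sub_mul hw ζ

lemma norm_integral_herglotz_sub_le {r : ℝ} (hr : r < 1) {z w : ℂ} (hz : ‖z‖ ≤ r) (hw : ‖w‖ ≤ r)
    (ν : Measure Circle) [IsFiniteMeasure ν] :
    ‖(∫ ζ : Circle, (1 + (ζ : ℂ) * z) / (1 - (ζ : ℂ) * z) ∂ν)
        - ∫ ζ : Circle, (1 + (ζ : ℂ) * w) / (1 - (ζ : ℂ) * w) ∂ν‖
      ≤ 2 / (1 - r) ^ 2 * ‖z - w‖ * ν.real Set.univ := by
  rw [← integral_sub ((continuous_herglotz (hz.trans_lt hr)).integrable_circle ν)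
    ((continuous_herglotz (hw.trans_lt hr)).integrable_circle ν)]
  exact norm_integral_le_of_norm_le_const (.of_forall (norm_herglotz_sub_le hr hz hw))

end Kernel

section SingleMeasure

/-- `∫ (1 - Re ζ) dν`. -/
def reDefect (ν : Measure Circle) : ℝ := ∫ ζ : Circle, (1 - (ζ : ℂ).re) ∂ν

/-- The Herglotz integral of the measure `(1 - Re ζ) dν`. -/
def weightedHerglotz (ν : Measure Circle) (z : ℂ) : ℂ :=
  ∫ ζ : Circle, ((1 + (ζ : ℂ) * z) / (1 - (ζ : ℂ) * z)) * ((1 - (ζ : ℂ).re : ℝ) : ℂ) ∂ν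

lemma reDefect_nonneg (ν : Measure Circle) : 0 ≤ reDefect ν :=
  integral_nonneg Circle.one_sub_re_nonneg

lemma continuous_one_sub_re : Continuous fun ζ : Circle => 1 - (ζ : ℂ).re := by fun_prop

lemma continuous_weighted_herglotz {z : ℂ} (hz : ‖z‖ < 1) : Continuous fun ζ : Circle =>
    ((1 + (ζ : ℂ) * z) / (1 - (ζ : ℂ) * z)) * ((1 - (ζ : ℂ).re : ℝ) : ℂ) :=
  (continuous_herglotz hz).mul (by fun_prop)

lemma norm_weightedHerglotz_le {r : ℝ} (hr : r < 1) {z : ℂ} (hz : ‖z‖ ≤ r)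
    (ν : Measure Circle) [IsFiniteMeasure ν] :
    ‖weightedHerglotz ν z‖ ≤ 2 / (1 - r) * reDefect ν := by
  rw [reDefect, ← integral_const_mul]
  refine norm_integral_le_of_norm_le
    ((continuous_const.mul continuous_one_sub_re).integrable_circle ν) (.of_forall fun ζ => ?_)
  rw [norm_mul, Complex.norm_real, Real.norm_of_nonneg (Circle.one_sub_re_nonneg ζ)]
  exact mul_le_mul_of_nonneg_right (norm_herglotz_le hr hz ζ) (Circle.one_sub_re_nonneg ζ)

lemma norm_weightedHerglotz_sub_le {r : ℝ} (hr : r < 1) {z w : ℂ} (hz : ‖z‖ ≤ r) (hw : ‖w‖ ≤ r)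
    (ν : Measure Circle) [IsFiniteMeasure ν] :
    ‖weightedHerglotz ν z - weightedHerglotz ν w‖
      ≤ 2 / (1 - r) ^ 2 * ‖z - w‖ * reDefect ν := by
  rw [weightedHerglotz, weightedHerglotz,
    ← integral_sub ((continuous_weighted_herglotz (hz.trans_lt hr)).integrable_circle ν)
      ((continuous_weighted_herglotz (hw.trans_lt hr)).integrable_circle ν),
    reDefect, ← integral_const_mul]
  refine norm_integral_le_of_norm_le
    ((continuous_const.mul continuous_one_sub_re).integrable_circle ν) (.of_forall fun ζ => ?_)
  rw [← sub_mul, norm_mul, Complex.norm_real, Real.norm_of_nonneg (Circle.one_sub_re_nonneg ζ)]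
  exact mul_le_mul_of_nonneg_right (norm_herglotz_sub_le hr hz hw ζ) (Circle.one_sub_re_nonneg ζ)

/-- The linearisation of `1 - BT ν z`. -/
def linearBT (ν : Measure Circle) (z : ℂ) : ℂ :=
  -Complex.I * ((∫ ζ : Circle, (ζ : ℂ).im ∂ν : ℝ) : ℂ) + weightedHerglotz ν z

lemma linearBT_eq (ν : Measure Circle) [IsFiniteMeasure ν] {z : ℂ} (hz : ‖z‖ < 1) :
    linearBT ν z = (1 - z) * ∫ ζ : Circle, (1 - (ζ : ℂ)) / (1 - (ζ : ℂ) * z) ∂ν := by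
  rw [linearBT, weightedHerglotz, ← integral_complex_ofReal, ← integral_const_mul,
    ← integral_const_mul, ← integral_add]
  · refine integral_congr_ae (.of_forall fun ζ => ?_)
    have h0 := one_sub_mul_ne_zero hz ζ
    have h1 : (ζ : ℂ) * (starRingEnd ℂ) ζ = 1 := by
      rw [Complex.mul_conj, Circle.normSq_coe, Complex.ofReal_one]
    have h2 : (ζ : ℂ) = (ζ : ℂ).re + (ζ : ℂ).im * Complex.I := (Complex.re_add_im _).symm
    have h3 : (starRingEnd ℂ) (ζ : ℂ) = (ζ : ℂ).re - (ζ : ℂ).im * Complex.I :=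
      Complex.ext (by simp) (by simp)
    simp only [Complex.ofReal_sub, Complex.ofReal_one]
    rw [← sub_eq_zero]
    have : -Complex.I * ((ζ : ℂ).im : ℂ)
        + (1 + (ζ : ℂ) * z) / (1 - (ζ : ℂ) * z) * (1 - ((ζ : ℂ).re : ℂ))
        - (1 - z) * ((1 - (ζ : ℂ)) / (1 - (ζ : ℂ) * z))
        = ((-Complex.I * ((ζ : ℂ).im : ℂ)) * (1 - (ζ : ℂ) * z)
          + (1 + (ζ : ℂ) * z) * (1 - ((ζ : ℂ).re : ℂ)) - (1 - z) * (1 - (ζ : ℂ)))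
            / (1 - (ζ : ℂ) * z) := by
      field_simp
    rw [this, div_eq_zero_iff]
    left
    linear_combination h2 - z * h1 + (ζ : ℂ) * z * h3
  · exact Continuous.integrable_circle (by fun_prop) ν
  · exact (continuous_weighted_herglotz hz).integrable_circle ν

lemma BT_eq_div (ν : Measure Circle) [IsProbabilityMeasure ν] {z : ℂ} (hz : ‖z‖ < 1) :
    BT ν z = (∫ ζ : Circle, (ζ : ℂ) / (1 - (ζ : ℂ) * z) ∂ν)
      / ∫ ζ : Circle, 1 / (1 - (ζ : ℂ) * z) ∂ν := by
  have hpsi : psiT ν z = z * ∫ ζ : Circle, (ζ : ℂ) / (1 - (ζ : ℂ) * z) ∂ν := by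
    rw [psiT, ← integral_const_mul]
    congr 1 with ζ
    ring
  have hone : 1 + psiT ν z = ∫ ζ : Circle, 1 / (1 - (ζ : ℂ) * z) ∂ν := by
    have ic : Integrable (fun ζ : Circle => ((ζ : ℂ) * z) / (1 - (ζ : ℂ) * z)) ν :=
      Continuous.integrable_circle
        (Continuous.div (by fun_prop) (by fun_prop) (one_sub_mul_ne_zero hz)) ν
    calc 1 + psiT ν z = (∫ _ : Circle, (1 : ℂ) ∂ν) + psiT ν z := by simp
      _ = ∫ ζ : Circle, 1 + ((ζ : ℂ) * z) / (1 - (ζ : ℂ) * z) ∂ν :=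
        (integral_add (continuous_const.integrable_circle ν) ic).symm
      _ = _ := by
        congr 1 with ζ
        have h0 := one_sub_mul_ne_zero hz ζ
        field_simp
        ring
  rw [BT]
  split_ifs with h
  · simp [h]
  · rw [hone, hpsi]
    field_simp

/-- `BT ν` is governed by its linearisation up to a quadratic error. -/
lemma exists_BT_eq_exp (ν : Measure Circle) [IsProbabilityMeasure ν] {r : ℝ} (hr0 : 0 ≤ r)
    (hr : r < 1) {z : ℂ} (hz : ‖z‖ ≤ r) (hH : ‖linearBT ν z‖ ≤ (1 - r) / 4) :
    ∃ e : ℂ, ‖e‖ ≤ (4 + 2 / (1 - r)) * ‖linearBT ν z‖ ^ 2 ∧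
      BT ν z = Complex.exp (-linearBT ν z + e) := by
  have hz1 : ‖z‖ < 1 := hz.trans_lt hr
  have hd : 0 < 1 - r := by linarith
  set H := linearBT ν z with hHdef
  have hne := one_sub_mul_ne_zero hz1
  have ic : Integrable (fun ζ : Circle => (ζ : ℂ) / (1 - (ζ : ℂ) * z)) ν :=
    Continuous.integrable_circle (Continuous.div (by fun_prop) (by fun_prop) hne) ν
  have ia : Integrable (fun ζ : Circle => 1 / (1 - (ζ : ℂ) * z)) ν :=
    Continuous.integrable_circle (Continuous.div (by fun_prop) (by fun_prop) hne) ν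
  set A := ∫ ζ : Circle, 1 / (1 - (ζ : ℂ) * z) ∂ν with hA
  set C := ∫ ζ : Circle, (ζ : ℂ) / (1 - (ζ : ℂ) * z) ∂ν with hC
  have hAC : A - z * C = 1 := by
    rw [hA, hC, ← integral_const_mul, ← integral_sub ia (ic.const_mul z)]
    have : ∀ ζ : Circle, 1 / (1 - (ζ : ℂ) * z) - z * ((ζ : ℂ) / (1 - (ζ : ℂ) * z)) = 1 := by
      intro ζ
      have h0 := hne ζ
      field_simp
    simp_rw [this]
    simp
  have hHD : H = (1 - z) * (A - C) := by
    rw [hHdef, linearBT_eq ν hz1, hA, hC, ← integral_sub ia ic]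
    congr 2 with ζ
    ring
  have hB : BT ν z = C / A := BT_eq_div ν hz1
  have hz2 : 1 - r ≤ ‖1 - z‖ := by simpa using one_sub_le_norm_one_sub_mul hz 1
  have hz0 : 1 - z ≠ 0 := norm_pos_iff.1 (hd.trans_le hz2)
  have hD : (1 - r) * ‖A - C‖ ≤ ‖H‖ := by
    rw [hHD, norm_mul]
    gcongr
  have hzD : ‖z * (A - C)‖ ≤ ‖A - C‖ := by
    rw [norm_mul]
    nlinarith [norm_nonneg (A - C)]
  have hD4 : ‖A - C‖ ≤ 1 / 4 := by nlinarith
  have hq : 1 / 2 ≤ ‖1 - z * (A - C)‖ := by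
    have h := norm_sub_norm_le (1 : ℂ) (z * (A - C))
    rw [norm_one] at h
    linarith
  have hq0 : 1 - z * (A - C) ≠ 0 := norm_pos_iff.1 (by linarith)
  have hzA : (1 - z) * A = 1 - z * (A - C) := by linear_combination hAC
  have hA0 : A ≠ 0 := by
    rintro h
    rw [h, mul_zero] at hzA
    exact hq0 (by rw [h]; exact hzA.symm)
  have h1B : 1 - BT ν z = H / (1 - z * (A - C)) := by
    rw [hB, hHD, ← hzA]
    field_simp
  have hlin : ‖1 - BT ν z - H‖ ≤ 2 / (1 - r) * ‖H‖ ^ 2 := by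
    have he : 1 - BT ν z - H = H * (z * (A - C)) / (1 - z * (A - C)) := by
      rw [h1B]
      field_simp
      ring
    rw [he, norm_div, norm_mul, div_le_iff₀ (by linarith)]
    have h3 : ‖A - C‖ ≤ ‖H‖ / (1 - r) := by
      rw [le_div_iff₀ hd]
      linarith
    calc ‖H‖ * ‖z * (A - C)‖ ≤ ‖H‖ * (‖H‖ / (1 - r)) := by gcongr; linarith
      _ = 2 / (1 - r) * ‖H‖ ^ 2 * (1 / 2) := by ring
      _ ≤ _ := by gcongr
  have hB2 : ‖BT ν z - 1‖ ≤ 2 * ‖H‖ := by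
    rw [norm_sub_rev, h1B, norm_div, div_le_iff₀ (by linarith)]
    nlinarith [norm_nonneg H]
  have hB12 : ‖BT ν z - 1‖ ≤ 1 / 2 := by linarith
  have hlog := Complex.norm_log_one_add_sub_self_le (z := BT ν z - 1) (by linarith)
  rw [add_sub_cancel] at hlog
  have hB0 : BT ν z ≠ 0 := by
    intro h
    rw [h] at hB12
    norm_num at hB12
  refine ⟨Complex.log (BT ν z) + H, ?_, ?_⟩
  · have h4 : Complex.log (BT ν z) + H
        = (Complex.log (BT ν z) - (BT ν z - 1)) - (1 - BT ν z - H) := by ring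
    have h5 : ‖BT ν z - 1‖ ^ 2 * (1 - ‖BT ν z - 1‖)⁻¹ / 2 ≤ 4 * ‖H‖ ^ 2 := by
      have h6 : (1 - ‖BT ν z - 1‖)⁻¹ ≤ 2 := by
        rw [inv_le_comm₀ (by linarith) two_pos]
        linarith
      have h7 : 0 ≤ 1 - ‖BT ν z - 1‖ := by linarith
      calc ‖BT ν z - 1‖ ^ 2 * (1 - ‖BT ν z - 1‖)⁻¹ / 2 ≤ (2 * ‖H‖) ^ 2 * 2 / 2 := by gcongr
        _ = _ := by ring
    rw [h4, add_mul]
    exact (norm_sub_le _ _).trans (add_le_add (hlog.trans h5) hlin)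
  · rw [neg_add_cancel_comm_assoc, Complex.exp_log hB0]

end SingleMeasure

section Centering

variable (τ : ℝ) (μ : Measure Circle)

lemma measurable_inv_mul (b : Circle) : Measurable fun ζ : Circle => b⁻¹ * ζ :=
  (continuous_const.mul continuous_id).measurable

instance [IsProbabilityMeasure μ] : IsProbabilityMeasure (centerT τ μ) :=
  Measure.isProbabilityMeasure_map (measurable_inv_mul _).aemeasurable

lemma integral_centerT {E : Type*} [NormedAddCommGroup E] [NormedSpace ℝ E] [CompleteSpace E]
    [IsFiniteMeasure μ] {f : Circle → E} (hf : Continuous f) :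
    ∫ ζ, f ζ ∂(centerT τ μ) = ∫ ζ, f ((bT τ μ)⁻¹ * ζ) ∂μ := by
  have : IsFiniteMeasure (Measure.map (fun ζ => (bT τ μ)⁻¹ * ζ) μ) :=
    Measure.isFiniteMeasure_map μ _
  exact integral_map (measurable_inv_mul _).aemeasurable (hf.integrable_circle _).1

lemma BT_eq_mul_BT_centerT [IsProbabilityMeasure μ] {z : ℂ} (hz : ‖z‖ < 1) :
    BT μ z = bT τ μ * BT (centerT τ μ) (bT τ μ * z) := by
  have hbz : ‖(bT τ μ : ℂ) * z‖ < 1 := by rwa [norm_mul, Circle.norm_coe, one_mul]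
  have hrot : ∀ ζ : Circle, (((bT τ μ)⁻¹ * ζ : Circle) : ℂ) * (bT τ μ * z) = ζ * z := fun ζ => by
    rw [← mul_assoc, ← Circle.coe_mul, mul_comm _ (bT τ μ), mul_inv_cancel_left]
  have hnum : Continuous fun ζ : Circle => (ζ : ℂ) / (1 - (ζ : ℂ) * (bT τ μ * z)) :=
    Continuous.div (by fun_prop) (by fun_prop) (one_sub_mul_ne_zero hbz)
  have hden : Continuous fun ζ : Circle => 1 / (1 - (ζ : ℂ) * (bT τ μ * z)) :=
    Continuous.div (by fun_prop) (by fun_prop) (one_sub_mul_ne_zero hbz)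
  rw [BT_eq_div μ hz, BT_eq_div _ hbz, integral_centerT τ μ hnum, integral_centerT τ μ hden,
    ← mul_div_assoc, ← integral_const_mul]
  simp_rw [hrot, ← mul_div_assoc, ← Circle.coe_mul, mul_inv_cancel_left]

/-- The mean distance to `1`. -/
def meanDist : ℝ := ∫ ζ : Circle, ‖(ζ : ℂ) - 1‖ ∂μ

variable {μ}

lemma measurableSet_abs_arg_lt : MeasurableSet {ζ : Circle | |Complex.arg (ζ : ℂ)| < τ} :=
  measurableSet_lt (by fun_prop) measurable_const

lemma integrable_indicator_arg [IsFiniteMeasure μ] : Integrable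
    ({ζ : Circle | |Complex.arg (ζ : ℂ)| < τ}.indicator fun ζ => Complex.arg (ζ : ℂ)) μ := by
  refine Integrable.indicator ?_ (measurableSet_abs_arg_lt τ)
  refine Integrable.of_bound (C := Real.pi) (Measurable.aestronglyMeasurable (by fun_prop))
    (.of_forall fun ζ => Complex.abs_arg_le_pi _)

lemma integrable_norm_sub_one [IsFiniteMeasure μ] :
    Integrable (fun ζ : Circle => ‖(ζ : ℂ) - 1‖) μ :=
  Continuous.integrable_circle (by fun_prop) μ

lemma abs_betaT_le [IsFiniteMeasure μ] : |betaT τ μ| ≤ Real.pi / 2 * meanDist μ := by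
  rw [betaT, ← integral_indicator (measurableSet_abs_arg_lt τ), meanDist, ← integral_const_mul,
    ← Real.norm_eq_abs]
  refine norm_integral_le_of_norm_le
    ((integrable_norm_sub_one (μ := μ)).const_mul _) (.of_forall fun ζ => ?_)
  exact (norm_indicator_le_norm_self _ _).trans (Circle.abs_arg_le_norm_sub_one ζ)

lemma reDefect_centerT [IsFiniteMeasure μ] :
    reDefect (centerT τ μ) = ∫ ζ : Circle, (1 - (((bT τ μ)⁻¹ * ζ : Circle) : ℂ).re) ∂μ :=
  integral_centerT τ μ continuous_one_sub_re

lemma reDefect_centerT_le [IsProbabilityMeasure μ] :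
    reDefect (centerT τ μ) ≤ meanDist μ + |betaT τ μ| := by
  have h1 : meanDist μ + |betaT τ μ| = ∫ ζ : Circle, (‖(ζ : ℂ) - 1‖ + |betaT τ μ|) ∂μ := by
    rw [integral_add integrable_norm_sub_one (integrable_const _)]
    simp [meanDist]
  rw [h1, reDefect_centerT]
  refine integral_mono (Continuous.integrable_circle (by fun_prop) μ)
    (integrable_norm_sub_one.add (integrable_const _)) fun ζ => ?_
  refine (Circle.one_sub_re_le_norm _).trans ?_
  rw [Circle.norm_inv_mul_sub_one]
  refine (norm_sub_le_norm_sub_add_norm_sub _ 1 _).trans ?_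
  rw [norm_sub_rev 1]
  exact add_le_add_right (Circle.norm_exp_sub_one_le _) _

lemma abs_integral_im_centerT_le [IsProbabilityMeasure μ] {τ : ℝ} (hτ : 0 < τ)
    (h1 : |betaT τ μ| ≤ 1) (h2 : |betaT τ μ| ≤ τ / Real.pi) (h3 : |betaT τ μ| ≤ Real.pi - τ) :
    |∫ ζ : Circle, (ζ : ℂ).im ∂(centerT τ μ)|
      ≤ (Real.pi ^ 2 + 4 * (Real.pi / τ) ^ 2) * reDefect (centerT τ μ) := by
  have hi : Integrable (fun ζ : Circle => (((bT τ μ)⁻¹ * ζ : Circle) : ℂ).im) μ :=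
    Continuous.integrable_circle (by fun_prop) μ
  have he : ∫ ζ : Circle, (ζ : ℂ).im ∂(centerT τ μ) = ∫ ζ : Circle,
      ((((bT τ μ)⁻¹ * ζ : Circle) : ℂ).im
        - {ζ : Circle | |Complex.arg (ζ : ℂ)| < τ}.indicator (fun ζ => Complex.arg (ζ : ℂ)) ζ
        + betaT τ μ) ∂μ := by
    have hsub : Integrable (fun ζ : Circle => (((bT τ μ)⁻¹ * ζ : Circle) : ℂ).im
        - {ζ : Circle | |Complex.arg (ζ : ℂ)| < τ}.indicator (fun ζ => Complex.arg (ζ : ℂ)) ζ) μ :=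
      hi.sub (integrable_indicator_arg τ)
    rw [integral_add hsub (integrable_const _),
      integral_sub hi (integrable_indicator_arg τ),
      integral_indicator (measurableSet_abs_arg_lt τ), ← betaT,
      integral_centerT τ μ (by fun_prop)]
    simp
  have hre : Integrable (fun ζ : Circle => 1 - (((bT τ μ)⁻¹ * ζ : Circle) : ℂ).re) μ :=
    Continuous.integrable_circle (by fun_prop) μ
  rw [he, reDefect_centerT, ← integral_const_mul, ← Real.norm_eq_abs]
  refine norm_integral_le_of_norm_le (hre.const_mul _) (.of_forall fun ζ => ?_)
  exact abs_im_sub_truncated_arg_add_le hτ h1 h2 h3 ζ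

/-- Each factor is the exponential of its linearisation at `z`, up to a small relative error. -/
lemma exists_BT_eq_exp_centered {τ : ℝ} (hτ : 0 < τ ∧ τ < Real.pi) {r : ℝ} (hr0 : 0 ≤ r)
    (hr : r < 1) : ∃ C > 0, ∃ δ > 0, ∀ μ : Measure Circle, IsProbabilityMeasure μ →
      meanDist μ ≤ δ → ∀ z : ℂ, ‖z‖ ≤ r → ∃ e : ℂ,
        ‖e‖ ≤ C * meanDist μ * reDefect (centerT τ μ) ∧
        BT μ z = Complex.exp (Complex.I * ((betaT τ μ
          + ∫ ζ : Circle, (ζ : ℂ).im ∂(centerT τ μ) : ℝ) : ℂ)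
            - weightedHerglotz (centerT τ μ) z + e) := by
  obtain ⟨hτ0, hτpi⟩ := hτ
  have hd : 0 < 1 - r := by linarith
  set L : ℝ := Real.pi ^ 2 + 4 * (Real.pi / τ) ^ 2 + 2 / (1 - r) with hL
  have hL0 : 0 < L := by positivity
  set Q : ℝ := 4 + 2 / (1 - r) with hQ
  have hQ0 : 0 < Q := by positivity
  have hpi3 := Real.pi_gt_three
  have hpi4 := Real.pi_lt_four
  have hpt : 0 < Real.pi - τ := by linarith
  obtain ⟨δ, hδ, hδ'⟩ : ∃ δ : ℝ, 0 < δ ∧ 2 * δ ≤ 1 ∧ 2 * δ ≤ τ / Real.pi ∧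
      2 * δ ≤ Real.pi - τ ∧ L * (3 * δ) ≤ (1 - r) / 4 := by
    refine ⟨min (min (1 / 2) (τ / Real.pi / 2)) (min ((Real.pi - τ) / 2) ((1 - r) / 4 / (L * 3))),
      by positivity, ?_, ?_, ?_, ?_⟩
    · have := (min_le_left (min (1 / 2) (τ / Real.pi / 2))
        (min ((Real.pi - τ) / 2) ((1 - r) / 4 / (L * 3)))).trans (min_le_left _ _)
      linarith
    · have := (min_le_left (min (1 / 2) (τ / Real.pi / 2))
        (min ((Real.pi - τ) / 2) ((1 - r) / 4 / (L * 3)))).trans (min_le_right _ _)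
      linarith
    · have := (min_le_right (min (1 / 2) (τ / Real.pi / 2))
        (min ((Real.pi - τ) / 2) ((1 - r) / 4 / (L * 3)))).trans (min_le_left _ _)
      linarith
    · have := (min_le_right (min (1 / 2) (τ / Real.pi / 2))
        (min ((Real.pi - τ) / 2) ((1 - r) / 4 / (L * 3)))).trans (min_le_right _ _)
      rw [le_div_iff₀ (by positivity)] at this
      linarith
  obtain ⟨hδ1, hδ2, hδ3, hδ4⟩ := hδ'
  refine ⟨3 * Q * L ^ 2 + 2 / (1 - r) ^ 2 * 2, by positivity, δ, hδ, ?_⟩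
  intro μ hμ hm z hz
  set m := meanDist μ with hmdef
  have hm0 : 0 ≤ m := integral_nonneg fun ζ => norm_nonneg _
  set s := reDefect (centerT τ μ) with hs
  have hs0 : 0 ≤ s := reDefect_nonneg _
  have hβ : |betaT τ μ| ≤ 2 * m := (abs_betaT_le τ).trans (by nlinarith)
  have hsm : s ≤ 3 * m := (reDefect_centerT_le τ).trans (by linarith)
  have him := abs_integral_im_centerT_le hτ0 (by linarith) (by linarith) (by linarith) (μ := μ)
  have hbz : ‖(bT τ μ : ℂ) * z‖ ≤ r := by rwa [norm_mul, Circle.norm_coe, one_mul]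
  have hH : ‖linearBT (centerT τ μ) (bT τ μ * z)‖ ≤ L * s := by
    refine (norm_add_le _ _).trans ?_
    rw [norm_mul, norm_neg, Complex.norm_I, one_mul, Complex.norm_real, hL, add_mul]
    exact add_le_add him (norm_weightedHerglotz_le hr hbz _)
  have hH' : ‖linearBT (centerT τ μ) (bT τ μ * z)‖ ≤ (1 - r) / 4 := by
    refine hH.trans (le_trans ?_ hδ4)
    gcongr
    linarith
  obtain ⟨e, he, hBe⟩ := exists_BT_eq_exp (centerT τ μ) hr0 hr hbz hH'
  refine ⟨e + (weightedHerglotz (centerT τ μ) z - weightedHerglotz (centerT τ μ) (bT τ μ * z)),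
    ?_, ?_⟩
  · have h1 : ‖e‖ ≤ 3 * Q * L ^ 2 * m * s := by
      refine he.trans ?_
      calc Q * ‖linearBT (centerT τ μ) (bT τ μ * z)‖ ^ 2 ≤ Q * (L * s) ^ 2 := by gcongr
        _ = Q * L ^ 2 * s * s := by ring
        _ ≤ Q * L ^ 2 * (3 * m) * s := by gcongr
        _ = _ := by ring
    have h2 := norm_weightedHerglotz_sub_le hr hz hbz (centerT τ μ)
    have h3 : ‖z - bT τ μ * z‖ ≤ 2 * m := by
      have h4 : z - bT τ μ * z = -(((bT τ μ : ℂ) - 1) * z) := by ring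
      rw [h4, norm_neg, norm_mul]
      have h5 : ‖(bT τ μ : ℂ) - 1‖ ≤ |betaT τ μ| := Circle.norm_exp_sub_one_le _
      calc ‖(bT τ μ : ℂ) - 1‖ * ‖z‖ ≤ (2 * m) * 1 := by
            gcongr
            · linarith
            · linarith
        _ = _ := mul_one _
    refine (norm_add_le _ _).trans ?_
    calc _ ≤ 3 * Q * L ^ 2 * m * s + 2 / (1 - r) ^ 2 * (2 * m) * s :=
          add_le_add h1 (h2.trans (by gcongr))
      _ = _ := by ring
  · have hb : (bT τ μ : ℂ) = Complex.exp (betaT τ μ * Complex.I) := Circle.coe_exp _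
    rw [BT_eq_mul_BT_centerT τ μ (hz.trans_lt hr), hBe, linearBT]
    nth_rw 1 [hb]
    rw [← Complex.exp_add]
    congr 1
    push_cast
    ring

end Centering

section Array

variable {τ : ℝ} {kn : ℕ → ℕ} {μ : ℕ → ℕ → Measure Circle}

lemma measurable_ofReal_one_sub_re :
    Measurable fun ζ : Circle => ENNReal.ofReal (1 - (ζ : ℂ).re) :=
  continuous_one_sub_re.measurable.ennreal_ofReal

lemma isFiniteMeasure_withDensity_one_sub_re (ν : Measure Circle) [IsFiniteMeasure ν] :
    IsFiniteMeasure (ν.withDensity fun ζ : Circle => ENNReal.ofReal (1 - (ζ : ℂ).re)) :=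
  isFiniteMeasure_withDensity_ofReal (continuous_one_sub_re.integrable_circle ν).2

lemma isFiniteMeasure_sigmaNT (hprob : ∀ n i, IsProbabilityMeasure (μ n i)) (n : ℕ) :
    IsFiniteMeasure (sigmaNT τ kn μ n) := by
  refine ⟨?_⟩
  rw [sigmaNT, Measure.finsetSum_apply, ENNReal.sum_lt_top]
  intro i _
  have := hprob n i
  have := isFiniteMeasure_withDensity_one_sub_re (centerT τ (μ n i))
  exact measure_lt_top _ _

lemma integral_sigmaNT {E : Type*} [NormedAddCommGroup E] [NormedSpace ℝ E]
    (hprob : ∀ n i, IsProbabilityMeasure (μ n i)) (n : ℕ) {f : Circle → E} (hf : Continuous f) :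
    ∫ ζ, f ζ ∂(sigmaNT τ kn μ n) = ∑ i ∈ Finset.range (kn n),
      ∫ ζ : Circle, (1 - (ζ : ℂ).re) • f ζ ∂(centerT τ (μ n i)) := by
  rw [sigmaNT, integral_finsetSum_measure]
  · refine Finset.sum_congr rfl fun i _ => ?_
    rw [integral_withDensity_eq_integral_toReal_smul measurable_ofReal_one_sub_re
      (.of_forall fun _ => ENNReal.ofReal_lt_top)]
    simp_rw [ENNReal.toReal_ofReal (Circle.one_sub_re_nonneg _)]
  · intro i _
    have := hprob n i
    have := isFiniteMeasure_withDensity_one_sub_re (centerT τ (μ n i))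
    exact hf.integrable_circle _

lemma sigmaNT_real_univ (hprob : ∀ n i, IsProbabilityMeasure (μ n i)) (n : ℕ) :
    (sigmaNT τ kn μ n).real Set.univ
      = ∑ i ∈ Finset.range (kn n), reDefect (centerT τ (μ n i)) := by
  have h := integral_sigmaNT (τ := τ) (kn := kn) hprob n
    (continuous_const (X := Circle) (y := (1 : ℝ)))
  simpa [reDefect] using h

lemma integral_herglotz_sigmaNT (hprob : ∀ n i, IsProbabilityMeasure (μ n i)) (n : ℕ) {z : ℂ}
    (hz : ‖z‖ < 1) :
    ∫ ζ : Circle, (1 + (ζ : ℂ) * z) / (1 - (ζ : ℂ) * z) ∂(sigmaNT τ kn μ n)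
      = ∑ i ∈ Finset.range (kn n), weightedHerglotz (centerT τ (μ n i)) z := by
  rw [integral_sigmaNT hprob n (continuous_herglotz hz)]
  refine Finset.sum_congr rfl fun i _ => ?_
  rw [weightedHerglotz]
  congr 1 with ζ
  rw [Complex.real_smul, mul_comm]

lemma IsInfinitesimalArrayT.eventually_meanDist_le
    (hprob : ∀ n i, IsProbabilityMeasure (μ n i)) (hinf : IsInfinitesimalArrayT kn μ)
    {ε : ℝ} (hε : 0 < ε) : ∀ᶠ n in atTop, ∀ i < kn n, meanDist (μ n i) ≤ ε := by
  obtain ⟨N, hN⟩ := hinf (ε / 2) (by positivity) (ENNReal.ofReal (ε / 4))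
    (ENNReal.ofReal_pos.2 (by positivity))
  filter_upwards [eventually_ge_atTop N] with n hn i hi
  have := hprob n i
  set S : Set Circle := {ζ : Circle | ε / 2 ≤ ‖(ζ : ℂ) - 1‖} with hS
  have hSm : MeasurableSet S := measurableSet_le measurable_const (by fun_prop)
  have hmeas : (μ n i).real S ≤ ε / 4 := by
    refine ENNReal.toReal_le_of_le_ofReal (by positivity) (hN n hn i hi).le
  have hind : Integrable (S.indicator fun _ => (2 : ℝ)) (μ n i) :=
    (integrable_const _).indicator hSm
  have hle : meanDist (μ n i) ≤
      ∫ ζ : Circle, (ε / 2 + S.indicator (fun _ => (2 : ℝ)) ζ) ∂(μ n i) := by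
    refine integral_mono integrable_norm_sub_one ((integrable_const _).add hind) fun ζ => ?_
    by_cases hζ : ζ ∈ S
    · have h2 : ‖(ζ : ℂ) - 1‖ ≤ 2 := by
        refine (norm_sub_le _ _).trans ?_
        rw [Circle.norm_coe, norm_one]; norm_num
      simp only [Set.indicator_of_mem hζ]
      linarith
    · simp only [Set.indicator_of_notMem hζ]
      have : ‖(ζ : ℂ) - 1‖ < ε / 2 := not_le.1 hζ
      linarith
  rw [integral_add (integrable_const _) hind, integral_indicator hSm] at hle
  simp at hle
  linarith

lemma tendsto_integral_complex_of_real {σn : ℕ → Measure Circle} {σ : Measure Circle}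
    [IsFiniteMeasure σ] [∀ n, IsFiniteMeasure (σn n)]
    (h : ∀ f : C(Circle, ℝ), Tendsto (fun n => ∫ ζ, f ζ ∂(σn n)) atTop (𝓝 (∫ ζ, f ζ ∂σ)))
    {f : Circle → ℂ} (hf : Continuous f) :
    Tendsto (fun n => ∫ ζ, f ζ ∂(σn n)) atTop (𝓝 (∫ ζ, f ζ ∂σ)) := by
  have key : ∀ ν : Measure Circle, IsFiniteMeasure ν →
      ∫ ζ, f ζ ∂ν = ((∫ ζ, (f ζ).re ∂ν : ℝ) : ℂ) + ((∫ ζ, (f ζ).im ∂ν : ℝ) : ℂ) * Complex.I :=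
    fun ν _ => (integral_re_add_im (hf.integrable_circle ν)).symm
  rw [key σ inferInstance]
  simp_rw [key (σn _) inferInstance]
  have hre := h ⟨fun ζ => (f ζ).re, by fun_prop⟩
  have him := h ⟨fun ζ => (f ζ).im, by fun_prop⟩
  exact ((Complex.continuous_ofReal.tendsto _).comp hre).add
    (((Complex.continuous_ofReal.tendsto _).comp him).mul_const _)

/-- Weak convergence gives continuous convergence of the Herglotz integrals. -/
lemma tendsto_integral_herglotz_prod {σn : ℕ → Measure Circle} {σ : Measure Circle}
    [IsFiniteMeasure σ] [∀ n, IsFiniteMeasure (σn n)]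
    (h : ∀ f : C(Circle, ℝ), Tendsto (fun n => ∫ ζ, f ζ ∂(σn n)) atTop (𝓝 (∫ ζ, f ζ ∂σ)))
    {x : ℂ} (hx : ‖x‖ < 1) :
    Tendsto (fun q : ℕ × ℂ => ∫ ζ : Circle, (1 + (ζ : ℂ) * q.2) / (1 - (ζ : ℂ) * q.2) ∂(σn q.1))
      (atTop ×ˢ 𝓝 x) (𝓝 (∫ ζ : Circle, (1 + (ζ : ℂ) * x) / (1 - (ζ : ℂ) * x) ∂σ)) := by
  obtain ⟨r, hxr, hr⟩ := exists_between hx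
  have hpt := (tendsto_integral_complex_of_real h (continuous_herglotz hx)).comp
    (tendsto_fst (f := atTop) (g := 𝓝 x))
  have hmass : Tendsto (fun n => (σn n).real Set.univ) atTop (𝓝 (σ.real Set.univ)) := by
    simpa using h 1
  have hball : ∀ᶠ y in 𝓝 x, ‖y‖ ≤ r :=
    (continuous_norm.tendsto x).eventually (eventually_le_nhds hxr)
  have hdist : Tendsto (fun q : ℕ × ℂ => ‖q.2 - x‖) (atTop ×ˢ 𝓝 x) (𝓝 0) := by
    have h0 : Tendsto (fun y : ℂ => ‖y - x‖) (𝓝 x) (𝓝 0) := by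
      have : Continuous fun y : ℂ => ‖y - x‖ := by fun_prop
      simpa using this.tendsto x
    exact h0.comp tendsto_snd
  have hbound : Tendsto (fun q : ℕ × ℂ => 2 / (1 - r) ^ 2 * ‖q.2 - x‖ * (σn q.1).real Set.univ)
      (atTop ×ˢ 𝓝 x) (𝓝 0) := by
    simpa using (hdist.const_mul (2 / (1 - r) ^ 2)).mul (hmass.comp tendsto_fst)
  have hdiff := squeeze_zero_norm'
    (a := fun q : ℕ × ℂ => 2 / (1 - r) ^ 2 * ‖q.2 - x‖ * (σn q.1).real Set.univ)
    (f := fun q : ℕ × ℂ =>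
      (∫ ζ : Circle, (1 + (ζ : ℂ) * q.2) / (1 - (ζ : ℂ) * q.2) ∂(σn q.1))
        - ∫ ζ : Circle, (1 + (ζ : ℂ) * x) / (1 - (ζ : ℂ) * x) ∂(σn q.1))
    ((tendsto_snd.eventually hball).mono fun q hq =>
      norm_integral_herglotz_sub_le hr hq hxr.le (σn q.1)) hbound
  simpa [Function.comp_def] using hdiff.add hpt

lemma continuousAt_BID (γ : Circle) (σ : Measure Circle) [IsFiniteMeasure σ] {x : ℂ}
    (hx : ‖x‖ < 1) : ContinuousAt (BID γ σ) x := by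
  have h := tendsto_integral_herglotz_prod (σn := fun _ => σ) (σ := σ)
    (fun f => tendsto_const_nhds) hx
  have hsnd : Tendsto (fun q : ℕ × ℂ => BID γ σ q.2) (atTop ×ˢ 𝓝 x) (𝓝 (BID γ σ x)) :=
    h.neg.cexp.const_mul _
  rwa [ContinuousAt, ← map_snd_prod (atTop : Filter ℕ) (𝓝 x), tendsto_map'_iff]

/-- The product of the factors is `γ_n exp (-∫ … dσ_n)` up to a uniformly small exponent. -/
lemma tendsto_prod_BT (hτ : 0 < τ ∧ τ < Real.pi) {γ : Circle} {σ : Measure Circle}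
    [IsFiniteMeasure σ] (hprob : ∀ n i, IsProbabilityMeasure (μ n i))
    (hinf : IsInfinitesimalArrayT kn μ) {lam : ℕ → Circle}
    (hσconv : ∀ f : C(Circle, ℝ),
      Tendsto (fun n => ∫ ζ, f ζ ∂(sigmaNT τ kn μ n)) atTop (𝓝 (∫ ζ, f ζ ∂σ)))
    (hγconv : Tendsto (fun n => gammaNT τ kn μ lam n) atTop (𝓝 (γ : ℂ)))
    {x : ℂ} (hx : ‖x‖ < 1) :
    Tendsto (fun q : ℕ × ℂ => (lam q.1 : ℂ) * ∏ i ∈ Finset.range (kn q.1), BT (μ q.1 i) q.2)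
      (atTop ×ˢ 𝓝 x) (𝓝 (BID γ σ x)) := by
  have := isFiniteMeasure_sigmaNT (τ := τ) (kn := kn) hprob
  obtain ⟨r, hxr, hr⟩ := exists_between hx
  have hr0 : 0 ≤ r := (norm_nonneg x).trans hxr.le
  obtain ⟨C, hC, δ, hδ, hfactor⟩ := exists_BT_eq_exp_centered hτ hr0 hr
  have hball : ∀ᶠ y in 𝓝 x, ‖y‖ ≤ r :=
    (continuous_norm.tendsto x).eventually (eventually_le_nhds hxr)
  have hmass : Tendsto (fun n => (sigmaNT τ kn μ n).real Set.univ) atTop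
      (𝓝 (σ.real Set.univ)) := by
    simpa using hσconv 1
  have hrep : ∀ q : ℕ × ℂ, ∃ E : ℂ, ((∀ i < kn q.1, meanDist (μ q.1 i) ≤ δ) → ‖q.2‖ ≤ r →
      (∀ ε, (∀ i < kn q.1, meanDist (μ q.1 i) ≤ ε) →
        ‖E‖ ≤ C * ε * (sigmaNT τ kn μ q.1).real Set.univ) ∧
      (lam q.1 : ℂ) * ∏ i ∈ Finset.range (kn q.1), BT (μ q.1 i) q.2
        = gammaNT τ kn μ lam q.1 * Complex.exp
          (-(∫ ζ : Circle, (1 + (ζ : ℂ) * q.2) / (1 - (ζ : ℂ) * q.2) ∂(sigmaNT τ kn μ q.1))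
            + E)) := by
    rintro ⟨n, z⟩
    by_cases hcond : (∀ i < kn n, meanDist (μ n i) ≤ δ) ∧ ‖z‖ ≤ r
    swap
    · exact ⟨0, fun h1 h2 => absurd ⟨h1, h2⟩ hcond⟩
    obtain ⟨hm, hz⟩ := hcond
    have hex : ∀ i, ∃ e : ℂ, i < kn n →
        ‖e‖ ≤ C * meanDist (μ n i) * reDefect (centerT τ (μ n i)) ∧
        BT (μ n i) z = Complex.exp (Complex.I * ((betaT τ (μ n i)
          + ∫ ζ : Circle, (ζ : ℂ).im ∂(centerT τ (μ n i)) : ℝ) : ℂ)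
            - weightedHerglotz (centerT τ (μ n i)) z + e) := by
      intro i
      by_cases hi : i < kn n
      · obtain ⟨e, he⟩ := hfactor (μ n i) (hprob n i) (hm i hi) z hz
        exact ⟨e, fun _ => he⟩
      · exact ⟨0, fun h => absurd h hi⟩
    choose e he using hex
    refine ⟨∑ i ∈ Finset.range (kn n), e i, fun _ _ => ⟨fun ε hε => ?_, ?_⟩⟩
    · refine (norm_sum_le _ _).trans ?_
      rw [sigmaNT_real_univ hprob, Finset.mul_sum]
      refine Finset.sum_le_sum fun i hi => ?_
      have hi' := Finset.mem_range.1 hi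
      refine (he i hi').1.trans ?_
      have := reDefect_nonneg (centerT τ (μ n i))
      gcongr
      exact hε i hi'
    · have hlam : (lam n : ℂ) = Complex.exp (Complex.arg (lam n : ℂ) * Complex.I) := by
        rw [← Circle.coe_exp, Circle.exp_arg]
      rw [Finset.prod_congr rfl fun i hi => (he i (Finset.mem_range.1 hi)).2, ← Complex.exp_sum,
        Finset.sum_add_distrib, Finset.sum_sub_distrib,
        integral_herglotz_sigmaNT hprob n (hz.trans_lt hr), gammaNT, ← Complex.exp_add]
      nth_rw 1 [hlam]
      rw [← Complex.exp_add, ← Finset.mul_sum]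
      congr 1
      push_cast
      rw [Finset.sum_add_distrib]
      ring
  choose E hE using hrep
  have hE0 : Tendsto E (atTop ×ˢ 𝓝 x) (𝓝 0) := by
    rw [NormedAddGroup.tendsto_nhds_zero]
    intro ε hε
    set M := σ.real Set.univ + 1 with hM
    have hM0 : 0 < M := by positivity
    have hmassM : ∀ᶠ n in atTop, (sigmaNT τ kn μ n).real Set.univ < M :=
      hmass.eventually (gt_mem_nhds (by linarith))
    have hη : 0 < ε / (2 * C * M) := by positivity
    filter_upwards [tendsto_fst.eventually hmassM, tendsto_snd.eventually hball,
      tendsto_fst.eventually (hinf.eventually_meanDist_le hprob hδ),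
      tendsto_fst.eventually (hinf.eventually_meanDist_le hprob hη)] with q h1 h2 h3 h4
    calc ‖E q‖ ≤ C * (ε / (2 * C * M)) * (sigmaNT τ kn μ q.1).real Set.univ :=
          (hE q h3 h2).1 _ h4
      _ ≤ C * (ε / (2 * C * M)) * M := by gcongr
      _ = ε / 2 := by field_simp
      _ < ε := by linarith
  have hlim : Tendsto (fun q : ℕ × ℂ => gammaNT τ kn μ lam q.1 * Complex.exp
      (-(∫ ζ : Circle, (1 + (ζ : ℂ) * q.2) / (1 - (ζ : ℂ) * q.2) ∂(sigmaNT τ kn μ q.1)) + E q))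
      (atTop ×ˢ 𝓝 x) (𝓝 (BID γ σ x)) := by
    have h1 := (tendsto_integral_herglotz_prod hσconv hx).neg.add hE0
    rw [add_zero] at h1
    exact (hγconv.comp tendsto_fst).mul h1.cexp
  refine hlim.congr' ?_
  filter_upwards [tendsto_snd.eventually hball,
    tendsto_fst.eventually (hinf.eventually_meanDist_le hprob hδ)] with q h2 h3
  exact (hE q h3 h2).2.symm

end Array

/-- Theorem 3.5, (3) ⇒ (1): if σ_n → σ weakly and γ_n → γ, then the boolean convolutions
δ_{λ_n} ⨃ μ_{n1} ⨃ ⋯ ⨃ μ_{nk_n} converge weakly to ν_⨃^{γ,σ}. -/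
theorem stmt6
    (τ : ℝ) (hτ : 0 < τ ∧ τ < Real.pi)
    (γ : Circle) (σ : Measure Circle) (hσ : IsFiniteMeasure σ)
    (kn : ℕ → ℕ) (μ : ℕ → ℕ → Measure Circle)
    (hprob : ∀ n i, IsProbabilityMeasure (μ n i))
    (hinf : IsInfinitesimalArrayT kn μ)
    (hmom : ∀ n : ℕ, ∀ i < kn n, (∫ ζ : Circle, (ζ : ℂ) ∂(μ n i)) ≠ 0)
    (lam : ℕ → Circle)
    (hσconv : ∀ f : C(Circle, ℝ),
      Tendsto (fun n => ∫ ζ, f ζ ∂(sigmaNT τ kn μ n)) atTop (𝓝 (∫ ζ, f ζ ∂σ)))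
    (hγconv : Tendsto (fun n => gammaNT τ kn μ lam n) atTop (𝓝 (γ : ℂ))) :
    ∀ K : Set ℂ, K ⊆ ball (0:ℂ) 1 → IsCompact K →
      TendstoUniformlyOn
        (fun n z => ((lam n : ℂ)) * ∏ i ∈ Finset.range (kn n), BT (μ n i) z)
        (BID γ σ) atTop K := by


  have hloc : TendstoLocallyUniformlyOn
      (fun n z => ((lam n : ℂ)) * ∏ i ∈ Finset.range (kn n), BT (μ n i) z)
      (BID γ σ) atTop (ball (0 : ℂ) 1) := by
    rw [tendstoLocallyUniformlyOn_iff_filter]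
    intro x hx
    have hx1 : ‖x‖ < 1 := mem_ball_zero_iff.1 hx
    rw [isOpen_ball.nhdsWithin_eq hx, tendstoUniformlyOnFilter_iff_tendsto]
    have hlim := ((continuousAt_BID γ σ hx1).tendsto.comp
      (tendsto_snd (f := (atTop : Filter ℕ)))).prodMk_nhds
        (tendsto_prod_BT hτ hprob hinf hσconv hγconv hx1)
    exact hlim.mono_right (nhds_le_uniformity _)
  exact (tendstoLocallyUniformlyOn_iff_forall_isCompact isOpen_ball).1 hloc

end
end

section
/- For every t > 0 and every λ ∈ 𝕋 there exists a Borel probability measure ν on 𝕋 with nonzero first moment such that B_ν(z) = exp(−t(1−λ)(1−z)/(1−λz)) for all z ∈ 𝔻; in particular B_ν is nonvanishing on 𝔻, so ν is ⨃-infinitely divisible (a boolean analogue of the Poisson distribution, equal to ν_⨃^{γ,σ} with γ = e^{it·Im λ} and σ = t(1−Re λ)δ_λ). -/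
open MeasureTheory Complex Filter Topology Metric

noncomputable section

theorem continuous_circle_coe : Continuous fun ζ : Circle ↦ (ζ : ℂ) := by
  fun_prop

/-- For `g` holomorphic on the closed unit disk, the average over the unit circle of the Cauchy-type
kernel `(w - z)⁻¹` against `Re (1 + 2 w g(w))` recovers `g z`. -/
theorem circleAverage_inv_sub_mul_re {g : ℂ → ℂ} (hg : DifferentiableOn ℂ g (closedBall 0 1))
    {z : ℂ} (hz : z ∈ ball (0 : ℂ) 1) :
    Real.circleAverage (fun w ↦ (w - z)⁻¹ * (((1 + 2 * w * g w).re : ℝ) : ℂ)) 0 1 = g z := by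
  have hz' : ‖z‖ < 1 := by simpa using hz
  set k : ℂ → ℂ := fun w ↦ (w + w * w * g w) / (1 - (starRingEnd ℂ) z * w) with hk
  have hden : ∀ w ∈ closedBall (0 : ℂ) 1, 1 - (starRingEnd ℂ) z * w ≠ 0 := by
    intro w hw h
    have h1 : ‖(starRingEnd ℂ) z * w‖ = 1 := by rw [← sub_eq_zero.1 h, norm_one]
    rw [norm_mul, RCLike.norm_conj] at h1
    have : ‖w‖ ≤ 1 := by simpa using hw
    nlinarith [norm_nonneg z, norm_nonneg w]
  have hkd : DifferentiableOn ℂ k (closedBall 0 1) := by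
    refine DifferentiableOn.div ?_ (by fun_prop) hden
    fun_prop
  have hk0 : Real.circleAverage k 0 1 = 0 := by
    rw [DiffContOnCl.circleAverage]
    · simp [hk]
    · simpa using hkd.diffContOnCl_ball subset_rfl
  have hg0 : Real.circleAverage (fun w ↦ ((w - 0) / (w - z)) • g w) 0 1 = g z :=
    DiffContOnCl.circleAverage_smul_div (by simpa using hg.diffContOnCl_ball subset_rfl)
      (by simpa using hz)
  have hkI : CircleIntegrable k 0 1 :=
    (hkd.continuousOn.mono sphere_subset_closedBall).circleIntegrable zero_le_one
  have hgI : CircleIntegrable (fun w ↦ ((w - 0) / (w - z)) • g w) 0 1 := by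
    refine ContinuousOn.circleIntegrable zero_le_one ?_
    have := hg.continuousOn.mono (sphere_subset_closedBall (x := (0 : ℂ)) (ε := 1))
    refine ContinuousOn.smul (f := fun w ↦ (w - 0) / (w - z)) (ContinuousOn.div ?_ ?_ ?_) this
    · fun_prop
    · fun_prop
    intro w hw h
    rw [sub_eq_zero.1 h] at hw
    simp at hw
    linarith
  have hck : Real.circleAverage ((conjCLE : ℂ →L[ℝ] ℂ) ∘ k) 0 1 = 0 := by
    rw [ContinuousLinearMap.circleAverage_comp_comm _ hkI, hk0, map_zero]
  have hckI : CircleIntegrable ((conjCLE : ℂ →L[ℝ] ℂ) ∘ k) 0 1 := by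
    refine ContinuousOn.circleIntegrable zero_le_one ?_
    exact (conjCLE : ℂ →L[ℝ] ℂ).continuous.comp_continuousOn
      (hkd.continuousOn.mono sphere_subset_closedBall)
  have hsum := Real.circleAverage_add hgI hckI
  rw [hg0, hck, add_zero] at hsum
  rw [← hsum]
  refine Real.circleAverage_congr_sphere fun w hw ↦ ?_
  have hw1 : ‖w‖ = 1 := by simpa using hw
  have hww : w * (starRingEnd ℂ) w = 1 := by
    rw [mul_conj, normSq_eq_norm_sq, hw1]; simp
  have hwz : w - z ≠ 0 := by
    intro h
    rw [sub_eq_zero.1 h] at hw1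
    linarith
  have hd : 1 - z * (starRingEnd ℂ) w ≠ 0 := by
    intro h
    apply hwz
    linear_combination w * h - (-z) * hww
  simp only [hk, Pi.add_apply, Function.comp_apply, ContinuousLinearEquiv.coe_coe,
    conjCLE_apply, map_div₀, map_add, map_sub, map_mul, map_one, conj_conj, smul_eq_mul, sub_zero,
    re_eq_add_conj, map_ofNat]
  field_simp
  have : w - z = w * (1 - z * (starRingEnd ℂ) w) := by linear_combination z * hww
  rw [this]
  linear_combination (-2 * (1 - z * (starRingEnd ℂ) w) *
    (1 + (starRingEnd ℂ) w * (starRingEnd ℂ) (g w))) * hww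

/-- A function `g`, holomorphic on the closed unit disk with `Re (1 + 2 w g(w)) ≥ 0`, is the Cauchy
transform of a probability measure on the circle. -/
theorem exists_probabilityMeasure_of_differentiableOn_closedBall {g : ℂ → ℂ}
    (hg : DifferentiableOn ℂ g (closedBall 0 1))
    (hpos : ∀ w ∈ closedBall (0 : ℂ) 1, 0 ≤ (1 + 2 * w * g w).re) :
    ∃ μ : ProbabilityMeasure Circle, ∀ z ∈ ball (0 : ℂ) 1,
      ∫ ζ : Circle, (ζ : ℂ) / (1 - ζ * z) ∂(μ : Measure Circle) = g z := by
  set P : ℝ → ℝ := fun θ ↦ (1 + 2 * circleMap 0 1 θ * g (circleMap 0 1 θ)).re with hP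
  have hmem : ∀ θ, circleMap 0 1 θ ∈ closedBall (0 : ℂ) 1 := fun θ ↦
    sphere_subset_closedBall (circleMap_mem_sphere _ zero_le_one θ)
  have hPc : Continuous P := by
    have : Continuous fun θ ↦ g (circleMap 0 1 θ) :=
      hg.continuousOn.comp_continuous (continuous_circleMap 0 1) hmem
    exact continuous_re.comp
      (continuous_const.add ((continuous_const.mul (continuous_circleMap 0 1)).mul this))
  have hP0 : ∀ θ, 0 ≤ (2 * Real.pi)⁻¹ * P θ := fun θ ↦
    mul_nonneg (by positivity) (hpos _ (hmem θ))
  set ρ : Measure ℝ := (volume.restrict (Set.Ioc 0 (2 * Real.pi))).withDensity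
    fun θ ↦ ENNReal.ofReal ((2 * Real.pi)⁻¹ * P θ) with hρ
  have hρint : ∀ f : ℝ → ℂ, ∫ θ, f θ ∂ρ =
      (2 * Real.pi)⁻¹ • ∫ θ in 0..2 * Real.pi, f θ * (P θ : ℂ) := by
    intro f
    rw [hρ, integral_withDensity_eq_integral_toReal_smul (by fun_prop) (by simp),
      intervalIntegral.integral_of_le (by positivity), ← integral_smul]
    refine integral_congr_ae (.of_forall fun θ ↦ ?_)
    simp only [ENNReal.toReal_ofReal (hP0 θ), real_smul]
    push_cast
    ring
  have hρ1 : IsProbabilityMeasure ρ := by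
    constructor
    rw [hρ, withDensity_apply _ MeasurableSet.univ, Measure.restrict_univ,
      ← ofReal_integral_eq_lintegral_ofReal
        ((hPc.const_mul _).integrableOn_Ioc) (.of_forall hP0),
      ← intervalIntegral.integral_of_le (by positivity), intervalIntegral.integral_const_mul]
    have hd : DifferentiableOn ℂ (fun w ↦ 1 + 2 * w * g w) (closedBall 0 1) := by fun_prop
    have h1 : Real.circleAverage (reCLM ∘ fun w ↦ 1 + 2 * w * g w) 0 1 = 1 := by
      rw [ContinuousLinearMap.circleAverage_comp_comm, DiffContOnCl.circleAverage]
      · simp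
      · simpa using hd.diffContOnCl_ball subset_rfl
      · exact (hd.continuousOn.mono sphere_subset_closedBall).circleIntegrable zero_le_one
    rw [Real.circleAverage_def, smul_eq_mul] at h1
    simpa [hP] using congrArg ENNReal.ofReal h1
  have hexp : Measurable fun θ : ℝ ↦ Circle.exp (-θ) :=
    (Circle.exp.continuous.comp continuous_neg).measurable
  refine ⟨⟨ρ.map fun θ ↦ Circle.exp (-θ),
    Measure.isProbabilityMeasure_map hexp.aemeasurable⟩, fun z hz ↦ ?_⟩
  have hmeas : Measurable fun ζ : Circle ↦ (ζ : ℂ) / (1 - ζ * z) := by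
    have : Measurable fun ζ : Circle ↦ (ζ : ℂ) := continuous_circle_coe.measurable
    fun_prop
  rw [ProbabilityMeasure.coe_mk, integral_map hexp.aemeasurable hmeas.aestronglyMeasurable, hρint,
    ← circleAverage_inv_sub_mul_re hg hz, Real.circleAverage_def]
  congr 2
  ext θ
  congr 1
  have h0 : circleMap 0 1 θ ≠ 0 := circleMap_ne_center one_ne_zero
  have h1 : ((Circle.exp (-θ) : Circle) : ℂ) = (circleMap 0 1 θ)⁻¹ := by
    rw [Circle.coe_exp, circleMap]
    simp [← Complex.exp_neg]
  rw [h1]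
  field_simp

/-- **Herglotz representation**: a function `g`, holomorphic on the open unit disk with
`Re (1 + 2 w g(w)) ≥ 0`, is the Cauchy transform of a probability measure on the circle. -/
theorem exists_probabilityMeasure_of_differentiableOn_ball {g : ℂ → ℂ}
    (hg : DifferentiableOn ℂ g (ball 0 1))
    (hpos : ∀ w ∈ ball (0 : ℂ) 1, 0 ≤ (1 + 2 * w * g w).re) :
    ∃ μ : ProbabilityMeasure Circle, ∀ z ∈ ball (0 : ℂ) 1,
      ∫ ζ : Circle, (ζ : ℂ) / (1 - ζ * z) ∂(μ : Measure Circle) = g z := by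
  set r : ℕ → ℝ := fun n ↦ 1 - 1 / ((n : ℝ) + 1) with hr
  have hr0 : ∀ n, 0 ≤ r n := fun n ↦ by
    simp only [hr, sub_nonneg]
    exact div_le_one_of_le₀ (by linarith [Nat.cast_nonneg (α := ℝ) n]) (by positivity)
  have hr1 : ∀ n, r n < 1 := fun n ↦ by
    simp only [hr]
    have : (0 : ℝ) < 1 / ((n : ℝ) + 1) := by positivity
    linarith
  have hrt : Tendsto r atTop (𝓝 1) := by
    simpa [hr] using (tendsto_one_div_add_atTop_nhds_zero_nat (𝕜 := ℝ)).const_sub 1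
  have hmaps : ∀ n, ∀ w ∈ closedBall (0 : ℂ) 1, (r n : ℂ) * w ∈ ball (0 : ℂ) 1 := by
    intro n w hw
    have hw : ‖w‖ ≤ 1 := by simpa using hw
    rw [mem_ball_zero_iff, norm_mul, norm_real, Real.norm_of_nonneg (hr0 n)]
    nlinarith [hr0 n, hr1 n, norm_nonneg w]
  have hex : ∀ n, ∃ μ : ProbabilityMeasure Circle, ∀ z ∈ ball (0 : ℂ) 1,
      ∫ ζ : Circle, (ζ : ℂ) / (1 - ζ * z) ∂(μ : Measure Circle) = r n * g (r n * z) := by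
    intro n
    refine exists_probabilityMeasure_of_differentiableOn_closedBall
      (g := fun z ↦ r n * g (r n * z)) ?_ fun w hw ↦ ?_
    · exact (hg.comp (by fun_prop) (hmaps n)).const_mul _
    · convert hpos _ (hmaps n w hw) using 3
      ring
  choose μ hμ using hex
  obtain ⟨ν, -, hν⟩ := (isCompact_univ (X := ProbabilityMeasure Circle)).ultrafilter_le_nhds
    ((hyperfilter ℕ : Ultrafilter ℕ).map μ) (by simp)
  have hν' : Tendsto μ (hyperfilter ℕ : Filter ℕ) (𝓝 ν) := hν
  refine ⟨ν, fun z hz ↦ ?_⟩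
  have hz' : ‖z‖ < 1 := by simpa using hz
  have hcont : Continuous fun ζ : Circle ↦ (ζ : ℂ) / (1 - ζ * z) := by
    refine continuous_circle_coe.div (by fun_prop) fun ζ h ↦ ?_
    have h1 : ‖(ζ : ℂ) * z‖ = 1 := by rw [← sub_eq_zero.1 h, norm_one]
    rw [norm_mul, Circle.norm_coe, one_mul] at h1
    linarith
  have h1 := (ProbabilityMeasure.tendsto_iff_forall_integral_rclike_tendsto ℂ).1 hν'
    (BoundedContinuousFunction.mkOfCompact ⟨_, hcont⟩)
  simp only [BoundedContinuousFunction.mkOfCompact_apply, ContinuousMap.coe_mk, hμ _ z hz] at h1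
  refine tendsto_nhds_unique h1 (Tendsto.mono_left ?_ Nat.hyperfilter_le_atTop)
  have hrc : Tendsto (fun n ↦ (r n : ℂ)) atTop (𝓝 1) := by
    simpa [Function.comp_def] using (continuous_ofReal.tendsto 1).comp hrt
  have hgz : Tendsto g (𝓝 (1 * z)) (𝓝 (g z)) := by
    rw [one_mul]
    exact (hg.continuousOn.continuousAt (isOpen_ball.mem_nhds hz)).tendsto
  simpa using hrc.mul (hgz.comp (hrc.mul_const z))

/-- Every holomorphic self-map of the unit disk (into its closure) is a `B`-transform. -/
theorem exists_BT_eq {B : ℂ → ℂ} (hB : DifferentiableOn ℂ B (ball 0 1))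
    (hB1 : ∀ z ∈ ball (0 : ℂ) 1, ‖B z‖ ≤ 1) :
    ∃ ν : Measure Circle, IsProbabilityMeasure ν ∧ ∀ z ∈ ball (0 : ℂ) 1, BT ν z = B z := by
  have hlt : ∀ z ∈ ball (0 : ℂ) 1, ‖z * B z‖ < 1 := by
    intro z hz
    have hz' : ‖z‖ < 1 := by simpa using hz
    rw [norm_mul]
    nlinarith [hB1 z hz, norm_nonneg z, norm_nonneg (B z)]
  have hne : ∀ z ∈ ball (0 : ℂ) 1, 1 - z * B z ≠ 0 := by
    intro z hz h
    have := hlt z hz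
    rw [← sub_eq_zero.1 h, norm_one] at this
    exact lt_irrefl _ this
  obtain ⟨ν, hν⟩ := exists_probabilityMeasure_of_differentiableOn_ball
    (g := fun z ↦ B z / (1 - z * B z)) (hB.div (by fun_prop) hne) (by
      intro w hw
      have h1 : 1 + 2 * w * (B w / (1 - w * B w)) = (1 + w * B w) / (1 - w * B w) := by
        have := hne w hw
        field_simp
        ring
      have h2 : normSq (w * B w) ≤ 1 := by
        rw [normSq_eq_norm_sq]
        nlinarith [hlt w hw, norm_nonneg (w * B w)]
      rw [h1, div_re, ← add_div]
      refine div_nonneg ?_ (normSq_nonneg _)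
      rw [normSq_apply] at h2
      simp only [add_re, sub_re, one_re, add_im, sub_im, one_im]
      nlinarith)
  refine ⟨ν, inferInstance, fun z hz ↦ ?_⟩
  rw [BT]
  split_ifs with h0
  · subst h0
    simpa using hν 0 hz
  · have hψ : psiT ν z = z * (B z / (1 - z * B z)) := by
      rw [psiT, ← hν z hz, ← integral_const_mul]
      congr 1
      ext ζ
      ring
    have h1 := hne z hz
    have h2 : 1 + psiT ν z = (1 - z * B z)⁻¹ := by
      rw [hψ]
      field_simp
      ring
    rw [h2, hψ]
    field_simp

/-- Corollary 3.8: for every t > 0 and λ ∈ 𝕋 there is a probability measure ν on the circle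
with nonzero first moment whose B-transform is exp(−t(1−λ)(1−z)/(1−λz)) on 𝔻; in particular
B_ν is nonvanishing on 𝔻, so ν is ⨃-infinitely divisible (a boolean Poisson law). -/
theorem stmt9 (t : ℝ) (ht : 0 < t) (lam : Circle) :
    ∃ ν : Measure Circle, IsProbabilityMeasure ν ∧
      (∫ ζ : Circle, (ζ : ℂ) ∂ν) ≠ 0 ∧
      (∀ z ∈ ball (0:ℂ) 1,
        BT ν z = Complex.exp (-(t : ℂ) * (1 - (lam : ℂ)) * ((1 - z) / (1 - (lam : ℂ) * z)))) ∧
      (∀ z ∈ ball (0:ℂ) 1, BT ν z ≠ 0) := by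
  have hlt : ∀ z ∈ ball (0 : ℂ) 1, ‖(lam : ℂ) * z‖ < 1 := by
    intro z hz
    rw [norm_mul, Circle.norm_coe, one_mul]
    exact mem_ball_zero_iff.1 hz
  have hne : ∀ z ∈ ball (0 : ℂ) 1, 1 - (lam : ℂ) * z ≠ 0 := by
    intro z hz h
    have := hlt z hz
    rw [← sub_eq_zero.1 h, norm_one] at this
    exact lt_irrefl _ this
  have hll : (lam : ℂ).re * (lam : ℂ).re + (lam : ℂ).im * (lam : ℂ).im = 1 := by
    rw [← normSq_apply, Circle.normSq_coe]
  have hre1 : (lam : ℂ).re ≤ 1 := by nlinarith [sq_nonneg (lam : ℂ).im]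
  obtain ⟨ν, hν, hBT⟩ := exists_BT_eq
    (B := fun z ↦ exp (-(t : ℂ) * (1 - (lam : ℂ)) * ((1 - z) / (1 - (lam : ℂ) * z))))
    (by
      refine DifferentiableOn.cexp (DifferentiableOn.const_mul ?_ _)
      exact DifferentiableOn.div (by fun_prop) (by fun_prop) hne)
    (by
      intro z hz
      set u : ℂ := (lam : ℂ) * z with hu
      have hu1 : normSq u ≤ 1 := by
        rw [normSq_eq_norm_sq]
        nlinarith [hlt z hz, norm_nonneg u]
      have hlc : (lam : ℂ) * (starRingEnd ℂ) (lam : ℂ) = 1 := by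
        rw [mul_conj, Circle.normSq_coe, ofReal_one]
      have hsplit : -(t : ℂ) * (1 - (lam : ℂ)) * ((1 - z) / (1 - u)) =
          ((-(t * (1 - (lam : ℂ).re)) : ℝ) : ℂ) * ((1 + u) / (1 - u)) +
            ((t * (lam : ℂ).im : ℝ) : ℂ) * I := by
        have h1 : 1 - u ≠ 0 := hne z hz
        have h2 : (lam : ℂ) = (lam : ℂ).re + (lam : ℂ).im * I := (re_add_im _).symm
        have h3 : (starRingEnd ℂ) (lam : ℂ) = (lam : ℂ).re - (lam : ℂ).im * I := by
          apply Complex.ext <;> simp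
        have hz : z = (starRingEnd ℂ) (lam : ℂ) * u := by
          rw [hu]; linear_combination (-z) * hlc
        have h4 : (1 - (lam : ℂ)) * (1 - z) = (1 - (lam : ℂ).re) * (1 + u) -
            (lam : ℂ).im * I * (1 - u) := by
          have : (1 - (lam : ℂ)) * (1 - z) = 1 - lam - (starRingEnd ℂ) (lam : ℂ) * u + u := by
            rw [← hz, hu]; ring
          rw [this, h3]
          linear_combination -h2
        push_cast
        field_simp
        linear_combination (-(t : ℂ)) * h4
      rw [norm_exp, Real.exp_le_one_iff, hsplit, add_re, re_ofReal_mul, re_ofReal_mul, I_re,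
        mul_zero, add_zero]
      refine mul_nonpos_of_nonpos_of_nonneg
        (neg_nonpos.2 (mul_nonneg ht.le (sub_nonneg.2 hre1))) ?_
      rw [div_re, ← add_div]
      refine div_nonneg ?_ (normSq_nonneg _)
      rw [normSq_apply] at hu1
      simp only [add_re, sub_re, one_re, add_im, sub_im, one_im]
      nlinarith)
  have hBT0 : ∀ z ∈ ball (0 : ℂ) 1, BT ν z ≠ 0 := fun z hz ↦ by
    rw [hBT z hz]
    exact exp_ne_zero _
  refine ⟨ν, hν, ?_, hBT, hBT0⟩
  simpa [BT] using hBT0 0 (by simp)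

end
end
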